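/- Let H be a real inner product space, l > 0, G ≥ 0, x* ∈ H, and f : H → ℝ differentiable. Let (x_k)_{k≥1} be a sequence in H satisfying x_{k+1} = x_k − (1/(l k)) ∇f(x_k) for all k ≥ 1, and suppose that for every k ≥ 1 the iterate satisfies ⟨∇f(x_k), x_k − x*⟩ ≥ l ‖x_k − x*‖² and ‖∇f(x_k)‖ ≤ G. Then for every k ≥ 2, ‖x_k − x*‖² ≤ G² / (l² (k − 1)). -/

import Mathlib

open RealInnerProductSpace

/-- Convergence of gradient descent with step sizes `γ_k = 1/(l k)`: if each iterate satisfies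
`⟪∇f(x_k), x_k - x*⟫ ≥ l ‖x_k - x*‖²` and `‖∇f(x_k)‖ ≤ G`, then
`‖x_k - x*‖² ≤ G² / (l² (k - 1))` for all `k ≥ 2`. -/
theorem gradient_descent_convergence {H : Type*} [NormedAddCommGroup H]
    [InnerProductSpace ℝ H] (l G : ℝ) (hl : 0 < l) (hG : 0 ≤ G)
    (xstar : H) (f : H → ℝ) (f' : H → H)
    (hdiff : ∀ x : H, HasFDerivAt f ((innerSL ℝ) (f' x)) x)
    (x : ℕ → H)
    (hupdate : ∀ k : ℕ, 1 ≤ k → x (k + 1) = x k - (1 / (l * (k : ℝ))) • f' (x k))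
    (hconv : ∀ k : ℕ, 1 ≤ k → ⟪f' (x k), x k - xstar⟫ ≥ l * ‖x k - xstar‖ ^ 2)
    (hbound : ∀ k : ℕ, 1 ≤ k → ‖f' (x k)‖ ≤ G) :
    ∀ k : ℕ, 2 ≤ k → ‖x k - xstar‖ ^ 2 ≤ G ^ 2 / (l ^ 2 * ((k : ℝ) - 1)) := by
  have hrec : ∀ k : ℕ, 1 ≤ k → l ^ 2 * (k : ℝ) ^ 2 * ‖x (k + 1) - xstar‖ ^ 2
      ≤ l ^ 2 * (k : ℝ) * ((k : ℝ) - 2) * ‖x k - xstar‖ ^ 2 + G ^ 2 := by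
    intro k hk
    have hk0 : (0 : ℝ) < k := by exact_mod_cast hk
    have e : x (k + 1) - xstar = (x k - xstar) - (1 / (l * (k : ℝ))) • f' (x k) := by
      rw [hupdate k hk]; abel
    have h1 : l ^ 2 * (k : ℝ) ^ 2 * ‖x (k + 1) - xstar‖ ^ 2
        = l ^ 2 * (k : ℝ) ^ 2 * ‖x k - xstar‖ ^ 2
          - 2 * (l * k) * ⟪f' (x k), x k - xstar⟫ + ‖f' (x k)‖ ^ 2 := by
      rw [e, norm_sub_sq_real, inner_smul_right, norm_smul, mul_pow, Real.norm_eq_abs, sq_abs,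
        real_inner_comm]
      field_simp
    have h2 := mul_le_mul_of_nonneg_left (hconv k hk) (mul_pos hl hk0).le
    have h3 := pow_le_pow_left₀ (norm_nonneg _) (hbound k hk) 2
    rw [h1]
    nlinarith
  have key : ∀ n : ℕ, l ^ 2 * ((n : ℝ) + 1) * ‖x (n + 2) - xstar‖ ^ 2 ≤ G ^ 2 := by
    intro n
    induction n with
    | zero =>
      have h := hrec 1 le_rfl
      norm_num at h ⊢
      have : 0 ≤ l ^ 2 * ‖x 1 - xstar‖ ^ 2 := by positivity
      linarith
    | succ n ih =>
      have h := hrec (n + 2) (by omega)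
      push_cast at h ⊢
      rw [show n + 1 + 2 = n + 2 + 1 by ring]
      have hn : (0 : ℝ) ≤ n := Nat.cast_nonneg n
      have hp : (0 : ℝ) < ((n : ℝ) + 2) * (n + 1) := by positivity
      refine le_of_mul_le_mul_left ?_ hp
      have a := mul_le_mul_of_nonneg_left h (by positivity : (0 : ℝ) ≤ (n : ℝ) + 1)
      have b := mul_le_mul_of_nonneg_left ih (by positivity : (0 : ℝ) ≤ ((n : ℝ) + 2) * n)
      have c := sq_nonneg G
      linarith
  intro k hk
  obtain ⟨n, rfl⟩ := Nat.exists_eq_add_of_le' hk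
  have h := key n
  have hc : ((n + 2 : ℕ) : ℝ) - 1 = n + 1 := by push_cast; ring
  rw [hc, le_div_iff₀ (by positivity)]
  linarith
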